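/- arXiv:0806.2140 — 3 statements merged into one kernel-verified Lean document; each statement's English description precedes it below -/
import Mathlib

section
/- If {X_1 = x_1, ..., X_k = x_k} (a conjunction of primitive events over distinct endogenous variables) is a cause of φ in (M,u⃗) according to the causal NESS test, where M is an acyclic causal model and u⃗ a context, then k = 1. -/
open scoped Classical

/-- A causal model: for each endogenous variable `X`, a structural equation `F X`
computing the value of `X` from the values of the exogenous variables and of the
(other) endogenous variables. -/
structure CausalModel (U : Type) (RU : U → Type) (V : Type) (R : V → Type) where
  F : (X : V) → ((u : U) → RU u) → ((Y : V) → R Y) → R X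

/-- A context: an assignment of values to the exogenous variables. -/
def Ctx (U : Type) (RU : U → Type) : Type := (u : U) → RU u

/-- A world: an assignment of values to the endogenous variables. -/
def World (V : Type) (R : V → Type) : Type := (X : V) → R X

variable {U : Type} {RU : U → Type} {V : Type} {R : V → Type}

/-- `v` is a solution of the structural equations of `M` in context `u`. -/
def Solves (M : CausalModel U RU V R) (u : Ctx U RU) (v : World V R) : Prop :=
  ∀ X, v X = M.F X u v

/-- `M` is acyclic: there is a strict total order on the endogenous variables such
that `F X` does not depend on the value of `Y` unless `Y ≺ X`. -/
def CausalModel.Acyclic (M : CausalModel U RU V R) : Prop :=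
  ∃ lt : V → V → Prop, IsStrictTotalOrder V lt ∧
    ∀ X Y : V, ¬ lt Y X →
      ∀ (u : Ctx U RU) (v : World V R) (y : R Y),
        M.F X u (Function.update v Y y) = M.F X u v

/-- A partial assignment of values to endogenous variables (an intervention). -/
def PAssign (V : Type) (R : V → Type) : Type := (X : V) → Option (R X)

/-- The partial assignment setting the variables in `A` to the values given by `w`. -/
noncomputable def restrictTo (A : Set V) (w : World V R) : PAssign V R :=
  fun X => if X ∈ A then some (w X) else none

/-- Combination of partial assignments, with priority to the first. -/
def PAssign.union (g h : PAssign V R) : PAssign V R :=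
  fun X => (g X).orElse (fun _ => h X)

/-- The partial assignment setting the single variable `X` to `x`. -/
noncomputable def PAssign.single (X : V) (x : R X) : PAssign V R :=
  fun Y => if h : X = Y then some (h ▸ x) else none

/-- The intervened model `M_{g}`: variables in the domain of `g` get the constant
equation given by `g`; the others keep their equation from `M`. -/
def intervene (M : CausalModel U RU V R) (g : PAssign V R) : CausalModel U RU V R where
  F := fun X u v => (g X).elim (M.F X u v) id

/-- Causal formulas: primitive events `X = x`, Boolean combinations, and
intervention formulas `[Y⃗ ← y⃗]φ`. -/
inductive CForm (V : Type) (R : V → Type) : Type where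
  | prim (X : V) (x : R X)
  | neg (φ : CForm V R)
  | conj (φ ψ : CForm V R)
  | intv (g : PAssign V R) (φ : CForm V R)

/-- A formula is an event if it is a Boolean combination of primitive events
(no interventions). -/
def CForm.IsEvent : CForm V R → Prop
  | .prim _ _ => True
  | .neg φ => φ.IsEvent
  | .conj φ ψ => φ.IsEvent ∧ ψ.IsEvent
  | .intv _ _ => False

/-- The endogenous variables mentioned in a formula. -/
def CForm.vars : CForm V R → Set V
  | .prim X _ => {X}
  | .neg φ => φ.vars
  | .conj φ ψ => φ.vars ∪ ψ.vars
  | .intv g φ => {X | g X ≠ none} ∪ φ.vars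

/-- Satisfaction of causal formulas: `(M,u) ⊨ X = x` iff `X` has value `x` in the
(unique, for acyclic models) solution; `(M,u) ⊨ [g]φ` iff `(M_g, u) ⊨ φ`. -/
def Sat : CausalModel U RU V R → Ctx U RU → CForm V R → Prop
  | M, u, .prim X x => ∃ v, Solves M u v ∧ v X = x
  | M, u, .neg φ => ¬ Sat M u φ
  | M, u, .conj φ ψ => Sat M u φ ∧ Sat M u ψ
  | M, u, .intv g φ => Sat (intervene M g) u φ

/-- AC1 and AC2 of the (updated) HP definition, with witnesses `W, w, xs'`:
`X⃗ = x⃗` (given by the set `Xs` of variables and values `xs`) is a weak cause of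
`φ` in `(M,u)`. -/
def WeakCause (M : CausalModel U RU V R) (u : Ctx U RU)
    (Xs : Finset V) (xs : World V R) (φ : CForm V R)
    (W : Set V) (w : World V R) (xs' : World V R) : Prop :=
  -- AC1
  (∀ X ∈ Xs, Sat M u (.prim X (xs X))) ∧ Sat M u φ ∧
  -- AC2: X⃗ is included in Z⃗ = Wᶜ
  Disjoint (↑Xs : Set V) W ∧
  ∀ zs : World V R, (∀ Z ∈ Wᶜ, Sat M u (.prim Z (zs Z))) →
    -- AC2(a)
    (Sat M u (.intv ((restrictTo (↑Xs) xs').union (restrictTo W w)) (.neg φ)) ∧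
    -- AC2(b)
    ∀ W' ⊆ W, ∀ Z' ⊆ Wᶜ,
      Sat M u (.intv (((restrictTo (↑Xs) xs).union (restrictTo W' w)).union
        (restrictTo Z' zs)) φ))

/-- The (updated) HP definition of actual cause: AC1, AC2 (for some witness), and
the minimality condition AC3. -/
def ActualCause (M : CausalModel U RU V R) (u : Ctx U RU)
    (Xs : Finset V) (xs : World V R) (φ : CForm V R) : Prop :=
  (∃ W w xs', WeakCause M u Xs xs φ W w xs') ∧
  ∀ Ys : Finset V, Ys ⊂ Xs → ¬ ∃ W w xs', WeakCause M u Ys xs φ W w xs'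

/-- A set of primitive events (given by the set `S` of variables with values `s`)
is sufficient for `φ` with respect to a set `Us` of contexts if
`(M, u') ⊨ [S̄]φ` for every context `u'` in `Us`. Here the intervention is given
directly by a partial assignment `g`. -/
def SufficientWrt (M : CausalModel U RU V R) (Us : Set (Ctx U RU))
    (g : PAssign V R) (φ : CForm V R) : Prop :=
  ∀ u' ∈ Us, Sat M u' (.intv g φ)

/-- `S̄` (the variables of `S` with values `s`) is strongly sufficient for `φ` in
`(M,u)` with respect to `Us`: `S̄ ∪ S̄'` is sufficient for `φ` with respect to `Us`
for every set `S̄'` of primitive events that hold in `(M,u)`. -/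
def StronglySufficientWrt (M : CausalModel U RU V R) (u : Ctx U RU)
    (Us : Set (Ctx U RU)) (S : Set V) (s : World V R) (φ : CForm V R) : Prop :=
  ∀ (S' : Set V) (s' : World V R), (∀ Z ∈ S', Sat M u (.prim Z (s' Z))) →
    SufficientWrt M Us ((restrictTo S s).union (restrictTo S' s')) φ

/-- NT1–NT3 of the causal NESS test for `X⃗ = x⃗` with witness `S̄ = (S, s)`,
relative to the set `Us` of contexts. -/
def NESSWitnessWrt (M : CausalModel U RU V R) (u : Ctx U RU) (Us : Set (Ctx U RU))
    (Xs : Finset V) (xs : World V R) (φ : CForm V R)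
    (S : Set V) (s : World V R) : Prop :=
  -- S̄ contains the conjuncts of X⃗ = x⃗
  (↑Xs : Set V) ⊆ S ∧ (∀ X ∈ Xs, s X = xs X) ∧
  -- NT1
  (∀ Y ∈ S, Sat M u (.prim Y (s Y))) ∧
  -- NT2
  StronglySufficientWrt M u Us S s φ ∧
  -- NT3
  ¬ StronglySufficientWrt M u Us (S \ (↑Xs : Set V)) s φ

/-- `X⃗ = x⃗` is a cause of `φ` in `(M,u)` with respect to `Us` according to the
causal NESS test: some witness `S̄` satisfies NT1–NT3, and (NT4) no strict subset
of the conjuncts of `X⃗ = x⃗` satisfies NT1–NT3. -/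
def NESSCauseWrt (M : CausalModel U RU V R) (u : Ctx U RU) (Us : Set (Ctx U RU))
    (Xs : Finset V) (xs : World V R) (φ : CForm V R) : Prop :=
  (∃ S s, NESSWitnessWrt M u Us Xs xs φ S s) ∧
  ∀ Ys : Finset V, Ys ⊂ Xs → ¬ ∃ S s, NESSWitnessWrt M u Us Ys xs φ S s

/-- The causal NESS test (sufficiency with respect to all contexts). -/
def NESSCause (M : CausalModel U RU V R) (u : Ctx U RU)
    (Xs : Finset V) (xs : World V R) (φ : CForm V R) : Prop :=
  NESSCauseWrt M u Set.univ Xs xs φ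

/-- a cause according to the causal NESS test is a single conjunct. -/
theorem nessCause_singleton
    {U : Type} {RU : U → Type} {V : Type} {R : V → Type}
    [Fintype U] [Fintype V] [∀ u, Nonempty (RU u)] [∀ X, Nonempty (R X)]
    (M : CausalModel U RU V R) (hM : M.Acyclic) (u : Ctx U RU)
    (Xs : Finset V) (xs : World V R) (φ : CForm V R) (hφ : φ.IsEvent)
    (h : NESSCause M u Xs xs φ) :
    Xs.card = 1 := by
  obtain ⟨⟨S, s, hXS, hs, hNT1, hNT2, hNT3⟩, hmin⟩ := h
  have hne : Xs.Nonempty := by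
    by_contra h0
    rw [Finset.not_nonempty_iff_eq_empty] at h0
    subst h0
    simp [hNT2] at hNT3
  obtain ⟨X, hX⟩ := hne
  by_contra hcard
  have hsub : Xs.erase X ⊆ Xs := Finset.erase_subset X Xs
  by_cases hT : StronglySufficientWrt M u Set.univ (S \ (↑(Xs.erase X) : Set V)) s φ
  · have hss : ({X} : Finset V) ⊂ Xs := by
      refine (Finset.singleton_subset_iff.2 hX).ssubset_of_ne ?_
      rintro rfl
      simp at hcard
    refine hmin {X} hss ⟨S \ (↑(Xs.erase X) : Set V), s, ?_, ?_, fun Y hY => hNT1 Y hY.1, hT, ?_⟩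
    · simpa using hXS hX
    · simpa using hs X hX
    · have hdiff : (S \ (↑(Xs.erase X) : Set V)) \ (↑({X} : Finset V) : Set V) = S \ ↑Xs := by
        ext Y
        by_cases hY : Y = X <;> simp_all
      rwa [hdiff]
  · exact hmin (Xs.erase X) (Finset.erase_ssubset hX)
      ⟨S, s, fun Y hY => hXS (hsub hY), fun Y hY => hs Y (hsub hY), hNT1, hNT2, hT⟩
end

section
/- Suppose X = x is a cause of φ in (M,u⃗) according to the causal NESS test with witness S̄, where M is an acyclic causal model, and there exist a (possibly empty) set T⃗ of endogenous variables not mentioned in φ or S̄ and a context u⃗' such that: SH1: (M,u⃗') ⊨ [S̄ − {X = x}]¬φ; SH2: each variable T in T⃗ is independent of all other endogenous variables in contexts u⃗ and u⃗', i.e., if W⃗ consists of all endogenous variables other than T, then for all settings t of T and w⃗ of W⃗, (M,u⃗) ⊨ T = t iff (M,u⃗) ⊨ [W⃗←w⃗](T = t), and similarly for context u⃗'; SH3: φ is determined by T⃗ and X in contexts u⃗ and u⃗', i.e., for all settings t⃗ of T⃗, all sets T⃗' of endogenous variables disjoint from T⃗ and X, all settings t⃗' of T⃗', and all values x' of X,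 (M,u⃗') ⊨ [T⃗←t⃗, T⃗'←t⃗', X←x']φ iff (M,u⃗) ⊨ [T⃗←t⃗, T⃗'←t⃗', X←x']φ; SH4: for all sets T⃗' of endogenous variables disjoint from the variables of S̄ and all settings t⃗' of T⃗', (M,u⃗) ⊨ [X←x, T⃗'←t⃗'] S̄ (i.e., every primitive event in S̄ holds after this intervention). Then X = x is an actual cause of φ in (M,u⃗) according to the HP definition. -/
open scoped Classical

variable {U : Type} {RU : U → Type} {V : Type} {R : V → Type}

theorem CausalModel.Acyclic.intervene {M : CausalModel U RU V R} (hM : M.Acyclic)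
    (g : PAssign V R) : (intervene M g).Acyclic := by
  obtain ⟨lt, hlt, h⟩ := hM
  refine ⟨lt, hlt, fun X Y hYX u v y => ?_⟩
  simp only [_root_.intervene, h X Y hYX u v y]

/-- A function that ignores updates outside `P` takes the same value on assignments
agreeing on `P`. -/
theorem apply_eq_of_update_invariant [Finite V] {β : Type*} (f : ((Y : V) → R Y) → β)
    (P : V → Prop) (hf : ∀ Y, ¬ P Y → ∀ v y, f (Function.update v Y y) = f v)
    (v w : (Y : V) → R Y) (hvw : ∀ Y, P Y → v Y = w Y) : f v = f w := by
  have := Fintype.ofFinite V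
  suffices h : ∀ A : Finset V, (∀ Y ∈ A, ¬ P Y) → f (A.piecewise v w) = f w by
    rw [← h (Finset.univ.filter fun Y => ¬ P Y) (by simp)]
    congr 1
    funext Y
    by_cases hY : P Y <;> simp [Finset.piecewise, hY, hvw]
  intro A
  induction A using Finset.induction_on with
  | empty => simp
  | insert Y A _ ih =>
    intro hA
    rw [Finset.piecewise_insert]
    convert (hf Y (hA Y (by simp)) (A.piecewise v w) (v Y)).trans
      (ih fun Z hZ => hA Z (by simp [hZ])) using 1

theorem CausalModel.Acyclic.existsUnique_solves [Finite V] [∀ X, Nonempty (R X)]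
    {M : CausalModel U RU V R} (hM : M.Acyclic) (u : Ctx U RU) :
    ∃! v, Solves M u v := by
  obtain ⟨lt, hlt, h⟩ := hM
  have hwf : WellFounded lt := Finite.wellFounded_of_trans_of_irrefl lt
  have hcongr (X : V) (v w : (Y : V) → R Y) (hvw : ∀ Y, lt Y X → v Y = w Y) :
      M.F X u v = M.F X u w :=
    apply_eq_of_update_invariant (M.F X u) (lt · X) (fun Y hY v y => h X Y hY u v y) v w hvw
  let step (X : V) (rec : (Y : V) → lt Y X → R Y) : R X :=
    M.F X u fun Y => if hY : lt Y X then rec Y hY else Classical.arbitrary (R Y)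
  refine ⟨hwf.fix step, fun X => ?_, fun w hw => funext fun X => ?_⟩
  · rw [hwf.fix_eq]
    exact hcongr X _ _ fun Y hY => by simp [hY]
  · induction X using hwf.induction with
    | _ X ih =>
      rw [hw X, hwf.fix_eq]
      exact hcongr X _ _ fun Y hY => by simp [hY, ih Y hY]

/-- Truth of an event in a world (intervention formulas get the value `False`). -/
def CForm.Holds (v : World V R) : CForm V R → Prop
  | .prim X x => v X = x
  | .neg φ => ¬ φ.Holds v
  | .conj φ ψ => φ.Holds v ∧ ψ.Holds v
  | .intv _ _ => False

theorem CForm.isEvent_prim (X : V) (x : R X) : (CForm.prim X x : CForm V R).IsEvent := trivial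

theorem Solves.sat_iff_holds [Finite V] [∀ X, Nonempty (R X)] {M : CausalModel U RU V R}
    (hM : M.Acyclic) {u : Ctx U RU} {v : World V R} (hv : Solves M u v)
    {φ : CForm V R} (hφ : φ.IsEvent) : Sat M u φ ↔ φ.Holds v := by
  induction φ with
  | prim X x =>
    constructor
    · rintro ⟨w, hw, rfl⟩
      rw [(hM.existsUnique_solves u).unique hw hv]
      rfl
    · exact fun h => ⟨v, hv, h⟩
  | neg φ ih => exact not_congr (ih hφ)
  | conj φ ψ ih₁ ih₂ => exact and_congr (ih₁ hφ.1) (ih₂ hφ.2)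
  | intv g φ => exact hφ.elim

theorem Solves.sat_intv_iff_holds [Finite V] [∀ X, Nonempty (R X)] {M : CausalModel U RU V R}
    (hM : M.Acyclic) {u : Ctx U RU} {g : PAssign V R} {v : World V R}
    (hv : Solves (intervene M g) u v) {φ : CForm V R} (hφ : φ.IsEvent) :
    Sat M u (.intv g φ) ↔ φ.Holds v :=
  hv.sat_iff_holds (hM.intervene g) hφ

theorem solves_intervene_iff {M : CausalModel U RU V R} {u : Ctx U RU} {g : PAssign V R}
    {v : World V R} : Solves (intervene M g) u v ↔
      ∀ Y, (g Y = none → v Y = M.F Y u v) ∧ ∀ y, g Y = some y → v Y = y := by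
  refine forall_congr' fun Y => ?_
  cases h : g Y <;> simp [intervene, h]

theorem restrictTo_apply (A : Set V) (w : World V R) (Y : V) :
    restrictTo A w Y = if Y ∈ A then some (w Y) else none := rfl

theorem restrictTo_union_apply (A : Set V) (w : World V R) (h : PAssign V R) (Y : V) :
    (restrictTo A w).union h Y = if Y ∈ A then some (w Y) else h Y := by
  by_cases hY : Y ∈ A <;> simp [restrictTo, PAssign.union, hY]

theorem PAssign.union_assoc (f g h : PAssign V R) :
    (f.union g).union h = f.union (g.union h) := by
  funext Y
  cases hY : f Y <;> simp [PAssign.union, hY]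

theorem PAssign.single_eq_restrictTo (X : V) (w : World V R) :
    PAssign.single X (w X) = restrictTo {X} w := by
  funext Y
  by_cases h : X = Y
  · subst h
    simp [PAssign.single, restrictTo]
  · simp [PAssign.single, restrictTo, h, Ne.symm h]

/-- If the value of `T` in context `u` does not react to setting all other variables, then
its structural equation is constant in that context. -/
theorem Solves.structuralEq_eq_of_independent [Finite V] [∀ X, Nonempty (R X)]
    {M : CausalModel U RU V R} (hM : M.Acyclic) {u : Ctx U RU} {a : World V R}
    (ha : Solves M u a) {T : V}
    (hT : ∀ (t : R T) (w : World V R), Sat M u (.prim T t) ↔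
      Sat M u (.intv (restrictTo ({T}ᶜ : Set V) w) (.prim T t)))
    (w : World V R) : M.F T u w = a T := by
  obtain ⟨v, hv⟩ : ∃ v : World V R, v = Function.update w T (M.F T u w) := ⟨_, rfl⟩
  have hvT : v T = M.F T u w := hv ▸ Function.update_self T _ w
  have hvY (Y : V) (hY : Y ≠ T) : v Y = w Y := hv ▸ Function.update_of_ne hY _ w
  have hFv : M.F T u v = M.F T u w := by
    obtain ⟨lt, hlt, h⟩ := hM
    exact hv ▸ h T T (hlt.irrefl T) u w _
  have hsol : Solves (intervene M (restrictTo ({T}ᶜ : Set V) w)) u v := by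
    rw [solves_intervene_iff]
    intro Y
    by_cases hY : Y = T
    · subst hY
      simp [restrictTo_apply, hvT, hFv]
    · simp [restrictTo_apply, hY, hvY]
  have h := (hT (M.F T u w) w).2
    ((hsol.sat_intv_iff_holds hM (CForm.isEvent_prim _ _)).2 hvT)
  exact ((ha.sat_iff_holds hM (CForm.isEvent_prim _ _)).1 h).symm

/-- No weak cause is empty: AC2(a) and AC2(b) conflict. -/
theorem not_weakCause_empty [Finite V] [∀ X, Nonempty (R X)] {M : CausalModel U RU V R}
    (hM : M.Acyclic) {u : Ctx U RU} {xs : World V R} {φ : CForm V R} {W : Set V}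
    {w xs' : World V R} : ¬ WeakCause M u ∅ xs φ W w xs' := by
  rintro ⟨-, -, -, h⟩
  obtain ⟨a, ha, -⟩ := hM.existsUnique_solves u
  obtain ⟨hneg, hpos⟩ := h a fun Z _ => ⟨a, ha, rfl⟩
  have heq : (restrictTo (↑(∅ : Finset V)) xs').union (restrictTo W w) =
      ((restrictTo (↑(∅ : Finset V)) xs).union (restrictTo W w)).union (restrictTo ∅ a) := by
    funext Y
    simp [PAssign.union_assoc, restrictTo_union_apply, restrictTo_apply]
  exact hneg (heq ▸ hpos W subset_rfl ∅ (Set.empty_subset _))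

/-- under conditions SH1–SH4, a cause `X = x` of `φ` in `(M,u⃗)`
according to the causal NESS test (with witness `S̄ = (S,s)`) is an actual cause
of `φ` in `(M,u⃗)` according to the HP definition. -/
theorem nessCause_implies_actualCause
    {U : Type} {RU : U → Type} {V : Type} {R : V → Type}
    [Fintype U] [Fintype V] [∀ u, Nonempty (RU u)] [∀ X, Nonempty (R X)]
    (M : CausalModel U RU V R) (hM : M.Acyclic) (u u' : Ctx U RU)
    (X : V) (x : R X) (xs : World V R) (hx : xs X = x)
    (φ : CForm V R) (hφ : φ.IsEvent)
    -- X = x is a cause of φ in (M,u) according to the causal NESS test,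
    -- with witness S̄ = (S, s):
    (S : Set V) (s : World V R)
    (hwit : NESSWitnessWrt M u Set.univ {X} xs φ S s)
    (hNT4 : ∀ Ys : Finset V, Ys ⊂ {X} →
      ¬ ∃ S' s', NESSWitnessWrt M u Set.univ Ys xs φ S' s')
    -- T⃗ is a set of endogenous variables not mentioned in φ or S̄:
    (Ts : Set V) (hTφ : Disjoint Ts φ.vars) (hTS : Disjoint Ts S)
    -- SH1:
    (SH1 : Sat M u' (.intv (restrictTo (S \ {X}) s) (.neg φ)))
    -- SH2:
    (SH2 : ∀ T ∈ Ts, ∀ (t : R T) (wv : World V R),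
      (Sat M u (.prim T t) ↔
        Sat M u (.intv (restrictTo ({T}ᶜ : Set V) wv) (.prim T t))) ∧
      (Sat M u' (.prim T t) ↔
        Sat M u' (.intv (restrictTo ({T}ᶜ : Set V) wv) (.prim T t))))
    -- SH3:
    (SH3 : ∀ (tv : World V R) (Ts' : Set V), Disjoint Ts' Ts → X ∉ Ts' →
      ∀ (tv' : World V R) (x' : R X),
        (Sat M u' (.intv (((restrictTo Ts tv).union (restrictTo Ts' tv')).union
            (PAssign.single X x')) φ) ↔
          Sat M u (.intv (((restrictTo Ts tv).union (restrictTo Ts' tv')).union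
            (PAssign.single X x')) φ)))
    -- SH4:
    (SH4 : ∀ Ts' : Set V, Disjoint Ts' S → ∀ tv' : World V R,
      ∀ Y ∈ S, Sat M u (.intv ((PAssign.single X x).union (restrictTo Ts' tv'))
        (.prim Y (s Y)))) :
    ActualCause M u {X} xs φ := by
  subst hx
  obtain ⟨a, ha, -⟩ := hM.existsUnique_solves u
  obtain ⟨b, hb, -⟩ := hM.existsUnique_solves u'
  have exists_sol (u : Ctx U RU) (g : PAssign V R) : ∃ v, Solves (intervene M g) u v :=
    ((hM.intervene g).existsUnique_solves u).exists
  obtain ⟨hXS, hsX, hNT1, hNT2, -⟩ := hwit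
  replace hXS : X ∈ S := hXS (by simp)
  replace hsX : s X = xs X := hsX X (by simp)
  have has (Y : V) (hY : Y ∈ S) : s Y = a Y :=
    ((ha.sat_iff_holds hM (CForm.isEvent_prim _ _)).1 (hNT1 Y hY)).symm
  have hxa : xs X = a X := hsX ▸ has X hXS
  have hTS' (Y : V) (hY : Y ∈ Ts) : Y ∉ S := Set.disjoint_left.1 hTS hY
  have hFa (T : V) (hT : T ∈ Ts) (w : World V R) : M.F T u w = a T :=
    ha.structuralEq_eq_of_independent hM (fun t w => (SH2 T hT t w).1) w
  have hFb (T : V) (hT : T ∈ Ts) (w : World V R) : M.F T u' w = b T :=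
    hb.structuralEq_eq_of_independent hM (fun t w => (SH2 T hT t w).2) w
  obtain ⟨c, hc⟩ := exists_sol u' (restrictTo (S \ {X}) s)
  have hφc : ¬ φ.Holds c := (hc.sat_intv_iff_holds hM (φ := .neg φ) hφ).1 SH1
  rw [solves_intervene_iff] at hc
  simp only [restrictTo_apply] at hc
  have hcS (Y : V) (hY : Y ∈ S) (hYX : Y ≠ X) : c Y = a Y := by
    rw [← has Y hY]
    exact (hc Y).2 _ (by simp [hY, hYX])
  have hcT (Y : V) (hY : Y ∈ Ts) : c Y = b Y := by
    rw [← hFb Y hY c]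
    exact (hc Y).1 (by simp [hTS' Y hY])
  refine ⟨⟨Ts ∪ (S \ {X}), c, c, ?_, ?_, ?_, fun zs hzs => ⟨?_, fun W' hW' Z' hZ' => ?_⟩⟩, ?_⟩
  · simp only [Finset.mem_singleton, forall_eq]
    exact ⟨a, ha, hxa.symm⟩
  · refine (ha.sat_iff_holds hM hφ).2 ?_
    refine (Solves.sat_intv_iff_holds hM (u := u) ?_ hφ).1
      (hNT2 ∅ a (by simp) u (Set.mem_univ _))
    rw [solves_intervene_iff]
    simp only [restrictTo_union_apply, restrictTo_apply]
    intro Y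
    have := ha Y
    grind
  · rw [Set.disjoint_left]
    have := hTS' X
    simp
    grind
  · have h3 := SH3 c (S \ {X}) (hTS.symm.mono_left Set.sdiff_subset) (by simp) c (c X)
    rw [PAssign.single_eq_restrictTo, PAssign.union_assoc] at h3
    obtain ⟨d, hd⟩ := exists_sol u
      ((restrictTo Ts c).union ((restrictTo (S \ {X}) c).union (restrictTo {X} c)))
    have hc' : Solves (intervene M
        ((restrictTo Ts c).union ((restrictTo (S \ {X}) c).union (restrictTo {X} c)))) u' c := by
      rw [solves_intervene_iff]
      simp only [restrictTo_union_apply, restrictTo_apply]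
      intro Y
      have := (hc Y).1
      grind
    rw [hc'.sat_intv_iff_holds hM hφ, hd.sat_intv_iff_holds hM hφ] at h3
    refine (Solves.sat_intv_iff_holds hM (v := d) ?_ (φ := .neg φ) hφ).2 (mt h3.2 hφc)
    rw [solves_intervene_iff] at hd ⊢
    simp only [restrictTo_union_apply, restrictTo_apply] at hd ⊢
    intro Y
    have := hd Y
    have := hTS' X
    simp only [Finset.coe_singleton]
    grind
  · have hzs' (Z : V) (hZ : Z ∈ Z') : zs Z = a Z :=
      ((ha.sat_iff_holds hM (CForm.isEvent_prim _ _)).1 (hzs Z (hZ' hZ))).symm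
    obtain ⟨e, he⟩ : ∃ e : World V R, ∀ Y, e Y = if Y ∈ W' then b Y else a Y :=
      ⟨_, fun _ => rfl⟩
    obtain ⟨v, hv⟩ := exists_sol u
      ((restrictTo {X} a).union (restrictTo (((W' ∩ Ts) ∪ Z') \ S) e))
    have hvS (Y : V) (hY : Y ∈ S) : v Y = a Y := by
      have h4 := SH4 (((W' ∩ Ts) ∪ Z') \ S) Set.disjoint_sdiff_left e Y hY
      rw [hxa, PAssign.single_eq_restrictTo] at h4
      rw [← has Y hY]
      exact (hv.sat_intv_iff_holds hM (CForm.isEvent_prim _ _)).1 h4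
    rw [solves_intervene_iff] at hv
    simp only [restrictTo_union_apply, restrictTo_apply] at hv
    have hZT (Y : V) (hY : Y ∈ Z') : Y ∉ Ts := fun h => hZ' hY (Or.inl h)
    have hW'' (Y : V) (hY : Y ∈ W') : Y ∈ Ts ∨ Y ∈ S ∧ Y ≠ X := hW' hY
    refine (Solves.sat_intv_iff_holds hM (v := v) ?_ hφ).2 ?_
    · rw [solves_intervene_iff, PAssign.union_assoc]
      simp only [restrictTo_union_apply, restrictTo_apply, Finset.coe_singleton]
      intro Y
      have := hv Y
      grind
    have h3 := SH3 e ((S ∪ Z') \ {X})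
      (Set.disjoint_left.2 fun Y hY hYT => hY.1.elim (hTS' Y hYT) fun h => hZT Y h hYT)
      (by simp) a (a X)
    rw [PAssign.single_eq_restrictTo, PAssign.union_assoc] at h3
    refine (Solves.sat_intv_iff_holds hM ?_ hφ).1 (h3.1 ?_)
    · rw [solves_intervene_iff]
      simp only [restrictTo_union_apply, restrictTo_apply]
      intro Y
      have := hv Y
      have := hFa Y
      grind
    obtain ⟨r, hr⟩ := exists_sol u' ((restrictTo S s).union (restrictTo (Z' ∪ (Ts \ W')) a))
    have hφr := (hr.sat_intv_iff_holds hM hφ).1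
      (hNT2 (Z' ∪ (Ts \ W')) a (fun Z _ => ⟨a, ha, rfl⟩) u' (Set.mem_univ _))
    refine (Solves.sat_intv_iff_holds hM (v := r) ?_ hφ).2 hφr
    rw [solves_intervene_iff] at hr ⊢
    simp only [restrictTo_union_apply, restrictTo_apply] at hr ⊢
    intro Y
    have := hr Y
    have := hFb Y
    grind
  · rintro Ys hYs ⟨W, w, xs', hw⟩
    rw [Finset.ssubset_singleton_iff] at hYs
    subst hYs
    exact not_weakCause_empty hM hw
end

section
/- For any set U of contexts of an acyclic causal model M: if {X_1 = x_1, ..., X_k = x_k} (a conjunction of primitive events over distinct endogenous variables) is a cause of φ in (M,u⃗) with respect to U according to the causal NESS test, then k = 1. -/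
open scoped Classical

variable {U : Type} {RU : U → Type} {V : Type} {R : V → Type}

/-- for any set of contexts `Us`, a cause in `(M,u⃗)` with respect to
`Us` according to the causal NESS test is a single conjunct. -/
theorem nessCauseWrt_singleton
    {U : Type} {RU : U → Type} {V : Type} {R : V → Type}
    [Fintype U] [Fintype V] [∀ u, Nonempty (RU u)] [∀ X, Nonempty (R X)]
    (M : CausalModel U RU V R) (hM : M.Acyclic)
    (Us : Set (Ctx U RU)) (u : Ctx U RU)
    (Xs : Finset V) (xs : World V R) (φ : CForm V R) (hφ : φ.IsEvent)
    (h : NESSCauseWrt M u Us Xs xs φ) :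
    Xs.card = 1 := by
  obtain ⟨⟨S, s, hXS, hsx, hNT1, hNT2, hNT3⟩, hmin⟩ := h
  have hne : Xs.Nonempty := by
    rw [Finset.nonempty_iff_ne_empty]
    rintro rfl
    exact hNT3 (by simpa using hNT2)
  obtain ⟨X, hX⟩ := hne
  by_contra hcard
  by_cases hSX : StronglySufficientWrt M u Us (S \ {X}) s φ
  · refine hmin (Xs.erase X) (Finset.erase_ssubset hX) ⟨S \ {X}, s, ?_, ?_, ?_, hSX, ?_⟩
    · rw [Finset.coe_erase]
      exact Set.sdiff_subset_sdiff_left hXS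
    · exact fun Y hY => hsx Y (Finset.mem_of_mem_erase hY)
    · exact fun Y hY => hNT1 Y hY.1
    · rwa [Set.sdiff_sdiff, Finset.coe_erase, Set.union_sdiff_self,
        Set.union_eq_self_of_subset_left (Set.singleton_subset_iff.2 (Finset.mem_coe.2 hX))]
  · refine hmin {X} ?_ ⟨S, s, ?_, ?_, hNT1, hNT2, ?_⟩
    · refine (Finset.singleton_subset_iff.2 hX).ssubset_of_ne ?_
      rintro rfl
      exact hcard (Finset.card_singleton X)
    · simpa using hXS hX
    · simpa using hsx X hX
    · rwa [Finset.coe_singleton]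
end
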